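/- Let Q be a well-founded poset and let ℱ be a subset of I_{<ω}(Q). The following are equivalent: (1) ℱ has no infinite antichain under inclusion; (2) ℱ^{<ω}, ordered by inclusion, is wqo; (3) ℱ^∪ is order-scattered, i.e. there is no order-embedding of the rationals ℚ into ℱ^∪ ordered by inclusion; (4) there is no order-embedding of the powerset of ℕ, ordered by inclusion, into ℱ^∪; (5) [ω]^{<ω} does not embed into ℱ^{<ω} as a join-subsemilattice; (6) ℱ^∪, ordered by inclusion, is well-founded. -/

import Mathlib

open Set

/-- The poset `Ω(ω*)`: pairs `(i,j)` of naturals with `i < j`,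
ordered by `(i,j) ≤ (i',j')` iff `i' ≤ i ∧ j ≤ j'`. We only need the carrier and the join. -/
abbrev OmegaStar : Type := {p : ℕ × ℕ // p.1 < p.2}

/-- The join in `Ω(ω*)`: `(i,j) ⊔ (i',j') = (min i i', max j j')`. -/
def omegaJoin (a b : OmegaStar) : OmegaStar :=
  ⟨(min a.1.1 b.1.1, max a.1.2 b.1.2),
    lt_of_le_of_lt (min_le_left _ _) (lt_of_lt_of_le a.2 (le_max_left _ _))⟩

/-- `Ω̲(ω*)`: `Ω(ω*)` with a new least element (`none`) adjoined. -/
abbrev OmegaStarBot : Type := Option OmegaStar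

/-- The join in `Ω̲(ω*)`. -/
def omegaBotJoin : OmegaStarBot → OmegaStarBot → OmegaStarBot
  | none, b => b
  | a, none => a
  | some a, some b => some (omegaJoin a b)

/-- `I_{<ω}(Q)`: the finitely generated initial segments of `Q`,
i.e. downward closures of finite subsets of `Q` (including `∅`). -/
def FinGenInit (Q : Type*) [Preorder Q] : Set (Set Q) :=
  {S | ∃ F : Finset Q, S = {x | ∃ y ∈ F, x ≤ y}}

/-- An ideal of a poset: a nonempty, up-directed, downward closed subset. -/
def IsIdeal {P : Type*} [Preorder P] (I : Set P) : Prop :=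
  I.Nonempty ∧ (∀ x ∈ I, ∀ y ∈ I, ∃ z ∈ I, x ≤ z ∧ y ≤ z) ∧
    ∀ x y : P, x ≤ y → y ∈ I → x ∈ I

/-- A completely meet-irreducible ideal: an ideal `I` for which there is an ideal `J ⊋ I`
contained in every ideal strictly containing `I`. -/
def CMIdeal {P : Type*} [Preorder P] (I : Set P) : Prop :=
  IsIdeal I ∧ ∃ J : Set P, IsIdeal J ∧ I ⊂ J ∧ ∀ K : Set P, IsIdeal K → I ⊂ K → J ⊆ K

/-- An ideal of a sub-poset `P` of `α`: a subset of `P`, nonempty, up-directed,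
downward closed within `P`. -/
def IsIdealIn {α : Type*} [Preorder α] (P I : Set α) : Prop :=
  I ⊆ P ∧ I.Nonempty ∧ (∀ x ∈ I, ∀ y ∈ I, ∃ z ∈ I, x ≤ z ∧ y ≤ z) ∧
    ∀ x ∈ P, ∀ y ∈ I, x ≤ y → x ∈ I

/-- A completely meet-irreducible ideal of the sub-poset `P`. -/
def CMIdealIn {α : Type*} [Preorder α] (P I : Set α) : Prop :=
  IsIdealIn P I ∧ ∃ J : Set α, IsIdealIn P J ∧ I ⊂ J ∧
    ∀ K : Set α, IsIdealIn P K → I ⊂ K → J ⊆ K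

/-- `{x} ∨ J`, the ideal `{z : z ≤ x ⊔ y for some y ∈ J}`. -/
def JoinUp {P : Type*} [SemilatticeSup P] (x : P) (J : Set P) : Set P :=
  {z | ∃ y ∈ J, z ≤ x ⊔ y}

/-- A nonempty chain `𝓘` of ideals is separating if for every `I ∈ 𝓘` with `I ≠ ⋃𝓘` and every
`x ∈ ⋃𝓘 \ I` there is `J ∈ 𝓘` with `I ⊄ {x} ∨ J`. -/
def Separating {P : Type*} [SemilatticeSup P] (𝓘 : Set (Set P)) : Prop :=
  ∀ I ∈ 𝓘, I ≠ ⋃₀ 𝓘 → ∀ x ∈ (⋃₀ 𝓘) \ I, ∃ J ∈ 𝓘, ¬ I ⊆ JoinUp x J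

/-- An independent subset of a join-semilattice: no member is below the join of finitely many
of the others. -/
def IndepSet {P : Type*} [SemilatticeSup P] (X : Set P) : Prop :=
  ∀ x ∈ X, ∀ F : Finset P, ∀ hF : F.Nonempty, ↑F ⊆ X \ {x} → ¬ x ≤ F.sup' hF id

/-- `ℱ^{<ω}`: unions of finite subfamilies of `ℱ` (including `∅`). -/
def finUnions {α : Type*} (ℱ : Set (Set α)) : Set (Set α) :=
  {S | ∃ G : Finset (Set α), ↑G ⊆ ℱ ∧ S = ⋃₀ ↑G}

/-- `ℱ^∪`: unions of arbitrary subfamilies of `ℱ`. -/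
def arbUnions {α : Type*} (ℱ : Set (Set α)) : Set (Set α) :=
  {S | ∃ G ⊆ ℱ, S = ⋃₀ G}

open Filter in
/-- A sequence of finitely generated initial segments of a well-founded poset in which no term is
contained in a later one has an independent subsequence. -/
theorem exists_independent_subsequence {Q : Type*} [PartialOrder Q]
    (hQ : WellFounded ((· < ·) : Q → Q → Prop)) {F : ℕ → Set Q} (hF : ∀ n, F n ∈ FinGenInit Q)
    (hbad : ∀ m n, m < n → ¬ F m ⊆ F n) :
    ∃ (g : ℕ → ℕ) (x : ℕ → Q), ∀ i j, x i ∈ F (g j) ↔ i = j := by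
  have : WellFoundedLT Q := ⟨hQ⟩
  let ρ : Q → Ordinal := IsWellFounded.rank (· < ·)
  choose G hG using hF
  have hmem (n : ℕ) (x : Q) : x ∈ F n ↔ ∃ y ∈ G n, x ≤ y := by rw [hG n]; rfl
  have hgt (n : ℕ) : ∀ᶠ m in (hyperfilter ℕ : Filter ℕ), n < m :=
    Nat.hyperfilter_le_atTop (eventually_gt_atTop n)
  -- the elements avoiding almost every `F m` form an upper set meeting every `G n`
  let N : Set Q := {x | ∀ᶠ m in (hyperfilter ℕ : Filter ℕ), x ∉ F m}
  have hN_up {x y : Q} (hxy : x ≤ y) (hx : x ∈ N) : y ∈ N := by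
    refine Eventually.mono hx fun m hm hy => hm ?_
    obtain ⟨z, hz, hyz⟩ := (hmem m y).1 hy
    exact (hmem m x).2 ⟨z, hz, hxy.trans hyz⟩
  have hN (n : ℕ) : ∃ x ∈ G n, x ∈ N := by
    refine (Ultrafilter.eventually_exists_mem_iff (is := (G n : Set Q))
      (P := fun x m => x ∉ F m) (G n).finite_toSet).1 ((hgt n).mono fun m hm => ?_)
    by_contra! h
    refine hbad n m hm fun x hx => ?_
    obtain ⟨y, hy, hxy⟩ := (hmem n x).1 hx
    obtain ⟨z, hz, hyz⟩ := (hmem m y).1 (h y hy)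
    exact (hmem m x).2 ⟨z, hz, hxy.trans hyz⟩
  have hmax (n : ℕ) : ∃ x, (x ∈ G n ∧ x ∈ N) ∧ ∀ y, y ∈ G n ∧ y ∈ N → ρ y ≤ ρ x := by
    obtain ⟨x, hx, h⟩ := Set.exists_max_image {x | x ∈ G n ∧ x ∈ N} ρ
      ((G n).finite_toSet.subset fun x hx => hx.1) (hN n)
    exact ⟨x, hx, h⟩
  choose x hx hxmax using hmax
  have hxF (n : ℕ) : x n ∈ F n := (hmem n _).2 ⟨x n, (hx n).1, le_rfl⟩
  -- otherwise, the ranks of the `x m` would have no minimum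
  have hsep : ∀ᶠ m in (hyperfilter ℕ : Filter ℕ),
      ∀ᶠ n in (hyperfilter ℕ : Filter ℕ), x n ∉ F m := by
    by_contra hcon
    have hdesc : ∀ᶠ m in (hyperfilter ℕ : Filter ℕ),
        ∀ᶠ n in (hyperfilter ℕ : Filter ℕ), ρ (x n) < ρ (x m) := by
      refine (Ultrafilter.eventually_not.2 hcon).mono fun m hm => ?_
      have hm' : ∀ᶠ n in (hyperfilter ℕ : Filter ℕ), ∃ y ∈ (G m : Set Q), x n ≤ y := by
        refine (Ultrafilter.eventually_not.2 hm).mono fun n hn => ?_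
        exact (hmem m _).1 (not_not.1 hn)
      obtain ⟨y, hy, hle⟩ := (Ultrafilter.eventually_exists_mem_iff (G m).finite_toSet).1 hm'
      obtain ⟨n₀, hn₀⟩ := hle.exists
      have hyN : y ∈ N := hN_up hn₀ (hx n₀).2
      filter_upwards [hle, hyN] with n hn hyn
      have hlt : x n < y := lt_of_le_of_ne hn fun h => hyn (h ▸ hxF n)
      exact (IsWellFounded.rank_lt_of_rel hlt).trans_le (hxmax m y ⟨hy, hyN⟩)
    obtain ⟨m, hm, hmin⟩ := WellFounded.has_min (InvImage.wf (fun n => ρ (x n)) wellFounded_lt)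
      {m | ∀ᶠ n in (hyperfilter ℕ : Filter ℕ), ρ (x n) < ρ (x m)} hdesc.exists
    obtain ⟨n, hn, hlt⟩ := (hdesc.and hm).exists
    exact hmin n hn hlt
  obtain ⟨g, -, hg⟩ := exists_seq_of_forall_finset_exists
    (fun n => ∀ᶠ k in (hyperfilter ℕ : Filter ℕ), x k ∉ F n)
    (fun m n => x m ∉ F n ∧ x n ∉ F m) fun s hs => by
      have h₁ : ∀ᶠ k in (hyperfilter ℕ : Filter ℕ), ∀ n ∈ s, x n ∉ F k ∧ x k ∉ F n :=
        (Finset.eventually_all s).2 fun n hn => (show x n ∈ N from (hx n).2).and (hs n hn)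
      exact (hsep.and h₁).exists
  refine ⟨g, fun i => x (g i), fun i j => ⟨fun h => ?_, fun h => h ▸ hxF _⟩⟩
  by_contra hij
  rcases lt_or_gt_of_ne hij with hlt | hlt
  · exact (hg i j hlt).1 h
  · exact (hg j i hlt).2 h

theorem exists_antichain_of_independent {α : Type*} {s : ℕ → Set α} {x : ℕ → α}
    (hx : ∀ i j, x i ∈ s j ↔ i = j) :
    IsAntichain (· ⊆ ·) (range s) ∧ (range s).Infinite := by
  refine ⟨?_, infinite_range_of_injective fun i j hij => (hx i j).1 (hij ▸ (hx i i).2 rfl)⟩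
  rintro _ ⟨i, rfl⟩ _ ⟨j, rfl⟩ hne hle
  exact hne (congrArg s ((hx i j).1 (hle ((hx i i).2 rfl))))

theorem subset_finUnions {α : Type*} (ℱ : Set (Set α)) : ℱ ⊆ finUnions ℱ := fun S hS =>
  ⟨{S}, by simpa using hS, by simp⟩

theorem sUnion_mem_finUnions {α : Type*} {ℱ G : Set (Set α)} (hG : G ⊆ ℱ) (hfin : G.Finite) :
    ⋃₀ G ∈ finUnions ℱ :=
  ⟨hfin.toFinset, by simpa using hG, by simp⟩

/-- An independent sequence yields a join-embedding of the finite subsets of `ℕ`. -/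
theorem exists_join_embedding_of_independent {α : Type*} {ℱ : Set (Set α)} {s : ℕ → Set α}
    {x : ℕ → α} (hs : ∀ i, s i ∈ ℱ) (hx : ∀ i j, x i ∈ s j ↔ i = j) :
    ∃ f : Finset ℕ → Set α, (∀ a, f a ∈ finUnions ℱ) ∧ Function.Injective f ∧
      ∀ a b, f (a ∪ b) = f a ∪ f b := by
  have hmem (a : Finset ℕ) (i : ℕ) : x i ∈ ⋃₀ (s '' a) ↔ i ∈ a := by simp [hx]
  refine ⟨fun a => ⋃₀ (s '' a), fun a => ?_, fun a b hab => ?_, fun a b => ?_⟩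
  · exact sUnion_mem_finUnions (by rintro _ ⟨i, -, rfl⟩; exact hs i) (a.finite_toSet.image s)
  · ext i
    rw [← hmem a, ← hmem b]
    exact iff_of_eq (congrArg (x i ∈ ·) hab)
  · simp only [Finset.coe_union, image_union, sUnion_union]

/-- Finite unions of members of a well-quasi-ordered family are well-quasi-ordered. -/
theorem partiallyWellOrderedOn_finUnions {α : Type*} {ℱ : Set (Set α)}
    (h : ℱ.PartiallyWellOrderedOn (· ⊆ ·)) :
    (finUnions ℱ).PartiallyWellOrderedOn (· ⊆ ·) := by
  refine ((PartiallyWellOrderedOn.partiallyWellOrderedOn_sublistForall₂ (· ⊆ ·)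
    h).image_of_monotone_on (f := fun l : List (Set α) => ⋃₀ {S : Set α | S ∈ l})
    (r' := fun S T : Set α => S ⊆ T) ?_).mono ?_
  · intro l₁ h₁ l₂ h₂ hl
    clear h₁ h₂
    simp only [sUnion_subset_iff, mem_ofPred_eq]
    induction hl with
    | nil => simp
    | cons hab _ ih =>
      intro S hS
      rcases List.mem_cons.1 hS with rfl | hS
      · exact hab.trans (subset_sUnion_of_mem (by simp))
      · exact (ih S hS).trans
          (sUnion_subset_sUnion fun T hT => List.mem_cons_of_mem _ hT)
    | cons_right _ ih =>
      intro S hS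
      exact (ih S hS).trans
        (sUnion_subset_sUnion fun T hT => List.mem_cons_of_mem _ hT)
  · rintro S ⟨G, hG, rfl⟩
    exact ⟨G.toList, fun S hS => hG (by simpa using hS), by simp⟩

/-- Arbitrary unions of members of a well-quasi-ordered family are well-founded. -/
theorem wellFounded_arbUnions {α : Type*} {ℱ : Set (Set α)}
    (h : ℱ.PartiallyWellOrderedOn (· ⊆ ·)) :
    WellFounded (fun A B : {S : Set α // S ∈ arbUnions ℱ} => A < B) := by
  rw [wellFounded_iff_isEmpty_descending_chain]
  refine ⟨fun ⟨U, hU⟩ => ?_⟩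
  have hanti : StrictAnti U := strictAnti_nat_of_succ_lt hU
  have hex (n : ℕ) : ∃ S ∈ ℱ, S ⊆ (U n).1 ∧ ¬ S ⊆ (U (n + 1)).1 := by
    obtain ⟨G, hG, hUG⟩ := (U n).2
    by_contra! hcon
    refine (hU n).not_ge (show (U n).1 ⊆ (U (n + 1)).1 from ?_)
    rw [hUG]
    exact sUnion_subset fun S hS => hcon S (hG hS) (hUG ▸ subset_sUnion_of_mem hS)
  choose S hS hSU hSn using hex
  obtain ⟨m, n, hmn, hle⟩ := h.exists_lt hS
  exact hSn m (hle.trans ((hSU n).trans (hanti.antitone (Nat.succ_le_of_lt hmn))))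

theorem finGenInit_subset_of_directed {Q ι : Type*} [Preorder Q] {S : Set Q}
    (hS : S ∈ FinGenInit Q) {T : ι → Set Q} (hT : ∀ i, IsLowerSet (T i)) [Nonempty ι]
    (hdir : Directed (· ⊆ ·) T) (h : S ⊆ ⋃ i, T i) : ∃ i, S ⊆ T i := by
  obtain ⟨F, rfl⟩ := hS
  obtain ⟨i, hi⟩ := Directed.exists_mem_subset_of_finset_subset_biUnion (s := F) hdir
    fun y hy => h ⟨y, hy, le_rfl⟩
  exact ⟨i, fun _ ⟨_, hy, hxy⟩ => hT i hxy (hi hy)⟩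

theorem isLowerSet_of_mem_finGenInit {Q : Type*} [Preorder Q] {S : Set Q}
    (hS : S ∈ FinGenInit Q) : IsLowerSet S := by
  obtain ⟨F, rfl⟩ := hS
  rintro x y hyx ⟨z, hz, hxz⟩
  exact ⟨z, hz, hyx.trans hxz⟩

theorem finUnions_subset_finGenInit {Q : Type*} [Preorder Q] {ℱ : Set (Set Q)}
    (hℱ : ℱ ⊆ FinGenInit Q) : finUnions ℱ ⊆ FinGenInit Q := by
  classical
  rintro _ ⟨G, hG, rfl⟩
  have hex (S : Set Q) (hS : S ∈ G) : ∃ F : Finset Q, S = {x | ∃ y ∈ F, x ≤ y} := hℱ (hG hS)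
  choose! F hF using hex
  refine ⟨G.biUnion F, ?_⟩
  ext x
  simp only [mem_sUnion, SetLike.mem_coe, Finset.mem_biUnion, mem_ofPred_eq]
  constructor
  · rintro ⟨S, hS, hx⟩
    rw [hF S hS] at hx
    obtain ⟨y, hy, hxy⟩ := hx
    exact ⟨y, ⟨S, hS, hy⟩, hxy⟩
  · rintro ⟨y, ⟨S, hS, hy⟩, hxy⟩
    refine ⟨S, hS, ?_⟩
    rw [hF S hS]
    exact ⟨y, hy, hxy⟩

theorem iUnion_mem_arbUnions {α ι : Type*} {ℱ : Set (Set α)} {T : ι → Set α}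
    (hT : ∀ i, T i ∈ finUnions ℱ) : ⋃ i, T i ∈ arbUnions ℱ := by
  choose G hG hTG using hT
  refine ⟨⋃ i, ↑(G i), iUnion_subset hG, ?_⟩
  rw [sUnion_iUnion]
  exact iUnion_congr hTG

/-- A join-embedding of the finite subsets of `ℕ` into `ℱ^{<ω}` extends to an order-embedding of
the powerset of `ℕ` into `ℱ^∪`. -/
theorem nonempty_powerset_embedding {Q : Type*} [Preorder Q] {ℱ : Set (Set Q)}
    (hℱ : ℱ ⊆ FinGenInit Q) {f : Finset ℕ → Set Q} (hf : ∀ a, f a ∈ finUnions ℱ)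
    (hinj : Function.Injective f) (hjoin : ∀ a b, f (a ∪ b) = f a ∪ f b) :
    Nonempty (Set ℕ ↪o {S : Set Q // S ∈ arbUnions ℱ}) := by
  have hfin (a : Finset ℕ) : f a ∈ FinGenInit Q := finUnions_subset_finGenInit hℱ (hf a)
  have hmono {a b : Finset ℕ} (hab : a ⊆ b) : f a ⊆ f b := by
    rw [← Finset.union_eq_right.2 hab, hjoin]
    exact subset_union_left
  refine ⟨OrderEmbedding.ofMapLEIff (fun X : Set ℕ =>
    ⟨⋃ a : {a : Finset ℕ // (a : Set ℕ) ⊆ X}, f a, iUnion_mem_arbUnions fun a => hf a⟩)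
    fun X Y => ⟨fun h n hn => ?_, fun h => ?_⟩⟩
  · have : Nonempty {a : Finset ℕ // (a : Set ℕ) ⊆ Y} := ⟨⟨∅, by simp⟩⟩
    have hle : f {n} ⊆ ⋃ a : {a : Finset ℕ // (a : Set ℕ) ⊆ Y}, f a :=
      (subset_iUnion (fun a : {a : Finset ℕ // (a : Set ℕ) ⊆ X} => f a)
        ⟨{n}, by simpa using hn⟩).trans h
    obtain ⟨⟨a, haY⟩, ha⟩ := finGenInit_subset_of_directed (hfin {n})
      (T := fun a : {a : Finset ℕ // (a : Set ℕ) ⊆ Y} => f a)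
      (fun a => isLowerSet_of_mem_finGenInit (hfin a)) (fun a b =>
        ⟨⟨a.1 ∪ b.1, by simpa using ⟨a.2, b.2⟩⟩, hmono Finset.subset_union_left,
          hmono Finset.subset_union_right⟩) hle
    have heq : {n} ∪ a = a := hinj (by rw [hjoin, union_eq_right.2 ha])
    exact haY (Finset.union_eq_right.1 heq (Finset.mem_singleton_self n))
  · exact iUnion_subset fun a =>
      subset_iUnion (fun a : {a : Finset ℕ // (a : Set ℕ) ⊆ Y} => f a) ⟨a, a.2.trans h⟩

theorem nonempty_rat_embedding_powerset : Nonempty (ℚ ↪o Set ℕ) := by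
  refine ⟨OrderEmbedding.ofMapLEIff
    (fun q => {n | (Denumerable.eqv ℚ).symm n ≤ q}) fun p q => ⟨fun h => ?_, fun h n hn => ?_⟩⟩
  · have hp : Denumerable.eqv ℚ p ∈ {n | (Denumerable.eqv ℚ).symm n ≤ p} := by simp
    simpa using h hp
  · exact le_trans hn h

/-- For a well-founded poset `Q` and `ℱ ⊆ I_{<ω}(Q)`, the following are
equivalent: (1) `ℱ` has no infinite antichain; (2) `ℱ^{<ω}` is wqo; (3) `ℱ^∪` is
order-scattered; (4) the powerset of `ℕ` does not order-embed into `ℱ^∪`; (5) `[ω]^{<ω}` does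
not embed into `ℱ^{<ω}` as a join-subsemilattice; (6) `ℱ^∪` is well-founded. -/
theorem finUnions_tfae {Q : Type*} [PartialOrder Q]
    (hQ : WellFounded ((· < ·) : Q → Q → Prop)) (ℱ : Set (Set Q))
    (hℱ : ℱ ⊆ FinGenInit Q) :
    List.TFAE [
      ∀ A : Set (Set Q), A ⊆ ℱ → IsAntichain (· ⊆ ·) A → A.Finite,
      WellFounded (fun A B : {S : Set Q // S ∈ finUnions ℱ} => A < B) ∧
        ∀ A : Set (Set Q), A ⊆ finUnions ℱ → IsAntichain (· ⊆ ·) A → A.Finite,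
      ¬ Nonempty (ℚ ↪o {S : Set Q // S ∈ arbUnions ℱ}),
      ¬ Nonempty (Set ℕ ↪o {S : Set Q // S ∈ arbUnions ℱ}),
      ¬ ∃ f : Finset ℕ → Set Q, (∀ a, f a ∈ finUnions ℱ) ∧ Function.Injective f ∧
          ∀ a b, f (a ∪ b) = f a ∪ f b,
      WellFounded (fun A B : {S : Set Q // S ∈ arbUnions ℱ} => A < B)] := by
  have hpwo_of (P : Prop) (hP : ∀ (s : ℕ → Set Q) (x : ℕ → Q), (∀ i, s i ∈ ℱ) →
      (∀ i j, x i ∈ s j ↔ i = j) → ¬ P) (h : P) : ℱ.PartiallyWellOrderedOn (· ⊆ ·) := by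
    rw [partiallyWellOrderedOn_iff_exists_lt]
    intro F hF
    by_contra! hbad
    obtain ⟨g, x, hx⟩ := exists_independent_subsequence hQ (fun n => hℱ (hF n)) hbad
    exact hP (F ∘ g) x (fun i => hF (g i)) hx h
  have hpwo : (∀ A : Set (Set Q), A ⊆ ℱ → IsAntichain (· ⊆ ·) A → A.Finite) →
      ℱ.PartiallyWellOrderedOn (· ⊆ ·) := hpwo_of _ fun s x hs hx h => by
    obtain ⟨hanti, hinf⟩ := exists_antichain_of_independent hx
    exact hinf (h _ (range_subset_iff.2 hs) hanti)
  tfae_have 1 → 2 := fun h => by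
    have hfin := partiallyWellOrderedOn_finUnions (hpwo h)
    exact ⟨hfin.wellFoundedOn, fun A hA hanti =>
      hanti.finite_of_partiallyWellOrderedOn (hfin.mono hA)⟩
  tfae_have 2 → 1 := fun h A hA => h.2 A (hA.trans (subset_finUnions ℱ))
  tfae_have 1 → 6 := fun h => wellFounded_arbUnions (hpwo h)
  tfae_have 6 → 3 := fun h ⟨e⟩ => by
    have : WellFoundedLT {S : Set Q // S ∈ arbUnions ℱ} := ⟨h⟩
    exact not_strictAnti_of_wellFoundedLT (fun n : ℕ => e (-(n : ℚ))) fun m n hmn =>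
      e.strictMono (by simpa using hmn)
  tfae_have 3 → 4 := fun h ⟨e⟩ => h (nonempty_rat_embedding_powerset.map fun e' => e'.trans e)
  tfae_have 4 → 5 := fun h ⟨_, hf, hinj, hjoin⟩ =>
    h (nonempty_powerset_embedding hℱ hf hinj hjoin)
  tfae_have 5 → 1 := fun h A hA hanti =>
    hanti.finite_of_partiallyWellOrderedOn ((hpwo_of _ (fun _ _ hs hx h =>
      h (exists_join_embedding_of_independent hs hx)) h).mono hA)
  tfae_finish
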